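/- arXiv:2603.07063 — 2 statements merged into one kernel-verified Lean document; each statement's English description precedes it below -/
import Mathlib

section
/- Existence, conjugation property, and Hölder continuity of the transfer limit B_i: for every x_cs = (x_c, x_s) ∈ Ũ the limit B_i(x_cs) := lim_{n→∞} 𝒜_i(0,n;x_c) 𝒜_i(n,0;x_cs) exists; B_i(x_c) = id for every x_c ∈ Ũ ∩ X_c; B_i(g(x_cs)) A_i(x_cs) = A_i(x_c) B_i(x_cs) whenever x_cs and g(x_cs) lie in Ũ; and there exist constants C > 0 and β_i > 0 such that ‖B_i(x_cs) − B_i(x̃_cs)‖ ≤ C‖x_cs − x̃_cs‖^{β_i} for all x_cs, x̃_cs ∈ Ũ. -/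
noncomputable section

open Filter Topology

/-- The forward linear cocycle over `g` generated by the family `Ai`:
`fwdCocycle g Ai n x = Ai(g^{n-1}x) ∘ ⋯ ∘ Ai(x) = 𝒜_i(n,0;x)`. -/
def fwdCocycle {Xcs Xi : Type*} [NormedAddCommGroup Xcs]
    [NormedAddCommGroup Xi] [NormedSpace ℝ Xi]
    (g : Xcs → Xcs) (Ai : Xcs → (Xi ≃L[ℝ] Xi)) : ℕ → Xcs → (Xi ≃L[ℝ] Xi)
  | 0, _ => ContinuousLinearEquiv.refl ℝ Xi
  | n + 1, x => (fwdCocycle g Ai n x).trans (Ai (g^[n] x))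

/-- A pointwise limit of functions whose increments decay geometrically and whose Hölder constants
grow at most geometrically is Hölder continuous. -/
theorem exists_holder_of_tendsto_of_geometric {X E : Type*} [NormedAddCommGroup X]
    [NormedAddCommGroup E] {u : ℕ → X → E} {B : X → E} {s : Set X} {a ρ b M β : ℝ}
    (ha : 0 ≤ a) (hρ0 : 0 < ρ) (hρ1 : ρ < 1) (hb : 0 ≤ b) (hM : 0 < M) (hβ : 0 < β)
    (hlim : ∀ x ∈ s, Tendsto (fun n => u n x) atTop (𝓝 (B x)))
    (hzero : ∀ x ∈ s, ∀ y ∈ s, u 0 x = u 0 y)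
    (hinc : ∀ x ∈ s, ∀ n, ‖u (n + 1) x - u n x‖ ≤ a * ρ ^ n)
    (hhol : ∀ x ∈ s, ∀ y ∈ s, ∀ n, ‖u n x - u n y‖ ≤ b * M ^ n * ‖x - y‖ ^ β) :
    ∃ C > (0 : ℝ), ∃ γ > (0 : ℝ), ∀ x ∈ s, ∀ y ∈ s, ‖B x - B y‖ ≤ C * ‖x - y‖ ^ γ := by
  obtain ⟨θ, hr1, hθ0, hθ1⟩ : ∃ θ : ℝ, ρ ^ (1 - θ) * M ^ θ < 1 ∧ 0 < θ ∧ θ < 1 := by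
    have hcont : Continuous fun θ : ℝ => ρ ^ (1 - θ) * M ^ θ :=
      (Real.continuous_const_rpow hρ0.ne' |>.comp (by fun_prop)).mul
        (Real.continuous_const_rpow hM.ne')
    have hev : ∀ᶠ θ : ℝ in 𝓝 0, ρ ^ (1 - θ) * M ^ θ < 1 :=
      hcont.continuousAt.eventually_lt_const (by simpa using hρ1)
    exact ((hev.filter_mono nhdsWithin_le_nhds).and
      (Ioo_mem_nhdsGT (zero_lt_one' ℝ))).exists
  set r := ρ ^ (1 - θ) * M ^ θ with hr
  set c := (2 * a) ^ (1 - θ) * (b * (M + 1)) ^ θ with hc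
  have hc0 : 0 ≤ c := by positivity
  refine ⟨c / (1 - r) + 1, by have := sub_pos.2 hr1; positivity, β * θ, by positivity,
    fun x hx y hy => ?_⟩
  have hstep : ∀ n, dist (u n x - u n y) (u (n + 1) x - u (n + 1) y)
      ≤ c * ‖x - y‖ ^ (β * θ) * r ^ n := by
    intro n
    rw [dist_comm, dist_eq_norm]
    set t := ‖u (n + 1) x - u (n + 1) y - (u n x - u n y)‖ with ht
    have ht0 : 0 ≤ t := norm_nonneg _
    have hdecay : t ≤ 2 * a * ρ ^ n := by
      rw [ht, sub_sub_sub_comm]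
      linarith [norm_sub_le (u (n + 1) x - u n x) (u (n + 1) y - u n y), hinc x hx n, hinc y hy n]
    have hgrow : t ≤ b * (M + 1) * M ^ n * ‖x - y‖ ^ β := by
      calc t ≤ b * M ^ (n + 1) * ‖x - y‖ ^ β + b * M ^ n * ‖x - y‖ ^ β :=
            (norm_sub_le _ _).trans (add_le_add (hhol x hx y hy _) (hhol x hx y hy _))
        _ = _ := by ring
    calc t = t ^ (1 - θ) * t ^ θ := by
          rw [← Real.rpow_add_of_nonneg ht0 (by linarith) hθ0.le, sub_add_cancel, Real.rpow_one]
      _ ≤ (2 * a * ρ ^ n) ^ (1 - θ) * (b * (M + 1) * M ^ n * ‖x - y‖ ^ β) ^ θ := by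
          have := sub_pos.2 hθ1
          gcongr
      _ = _ := by
          rw [Real.mul_rpow (x := 2 * a) (by positivity) (by positivity),
            Real.mul_rpow (x := b * (M + 1) * M ^ n) (by positivity) (by positivity),
            Real.mul_rpow (x := b * (M + 1)) (by positivity) (by positivity),
            ← Real.rpow_mul (norm_nonneg _), hc, hr, mul_pow,
            Real.rpow_pow_comm hρ0.le, Real.rpow_pow_comm hM.le]
          ring
  have hdist := dist_le_of_le_geometric_of_tendsto₀ r _ hr1 hstep ((hlim x hx).sub (hlim y hy))
  rw [hzero x hx y hy, sub_self, dist_zero_left] at hdist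
  refine hdist.trans ?_
  rw [add_mul, one_mul, div_mul_eq_mul_div]
  exact le_add_of_nonneg_right (by positivity)

section Cocycle

variable {Xcs Xi : Type*} [NormedAddCommGroup Xcs] [NormedAddCommGroup Xi] [NormedSpace ℝ Xi]
  (g : Xcs → Xcs) (Ai : Xcs → (Xi ≃L[ℝ] Xi))

theorem fwdCocycle_succ_apply (n : ℕ) (x : Xcs) (v : Xi) :
    fwdCocycle g Ai (n + 1) x v = Ai (g^[n] x) (fwdCocycle g Ai n x v) := rfl

theorem fwdCocycle_succ' (n : ℕ) (x : Xcs) :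
    fwdCocycle g Ai (n + 1) x = (Ai x).trans (fwdCocycle g Ai n (g x)) := by
  induction n with
  | zero => rfl
  | succ n ih =>
    ext v
    rw [fwdCocycle_succ_apply, ih]
    rfl

/-- The comparison operator `𝒜_i(0,n;y) 𝒜_i(n,0;x)` of two orbits. -/
def comparison (n : ℕ) (y x : Xcs) : Xi →L[ℝ] Xi :=
  ((fwdCocycle g Ai n y).symm : Xi →L[ℝ] Xi).comp (fwdCocycle g Ai n x : Xi →L[ℝ] Xi)

theorem comparison_succ_sub (n : ℕ) (y x : Xcs) :
    comparison g Ai (n + 1) y x - comparison g Ai n y x =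
      ((fwdCocycle g Ai (n + 1) y).symm : Xi →L[ℝ] Xi).comp
        (((Ai (g^[n] x) : Xi →L[ℝ] Xi) - (Ai (g^[n] y) : Xi →L[ℝ] Xi)).comp
          (fwdCocycle g Ai n x : Xi →L[ℝ] Xi)) := by
  ext v
  simp [comparison, fwdCocycle]

theorem comparison_comp (n : ℕ) (y x : Xcs) :
    (comparison g Ai n (g y) (g x)).comp (Ai x : Xi →L[ℝ] Xi) =
      (Ai y : Xi →L[ℝ] Xi).comp (comparison g Ai (n + 1) y x) := by
  ext v
  simp [comparison, fwdCocycle_succ']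

variable {g Ai} {K lam ς μ βE L : ℝ}

theorem norm_comparison_succ_sub_le {lsp : ℝ} {y x : Xcs} (hK : 0 ≤ K) (hμ : 0 ≤ μ)
    (hlsp : 0 ≤ lsp) (hβE : 0 ≤ βE) (hL : 0 ≤ L)
    (hAiH : ∀ x y : Xcs,
      ‖(Ai x : Xi →L[ℝ] Xi) - (Ai y : Xi →L[ℝ] Xi)‖ ≤ L * ‖x - y‖ ^ βE)
    (hfwd : ∀ n x, ‖(fwdCocycle g Ai n x : Xi →L[ℝ] Xi)‖ ≤ K * lam ^ n)
    (hbwd : ∀ n x, ‖((fwdCocycle g Ai n x).symm : Xi →L[ℝ] Xi)‖ ≤ K * μ ^ n)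
    (n : ℕ) (hxy : ‖g^[n] x - g^[n] y‖ ≤ K * lsp ^ n) :
    ‖comparison g Ai (n + 1) y x - comparison g Ai n y x‖ ≤
      K * μ * (L * K ^ βE) * K * (lam * μ * lsp ^ βE) ^ n := by
  rw [comparison_succ_sub]
  calc _ ≤ (K * μ ^ (n + 1)) * ((L * (K * lsp ^ n) ^ βE) * (K * lam ^ n)) := by
        refine (ContinuousLinearMap.opNorm_comp_le _ _).trans ?_
        refine mul_le_mul (hbwd _ _) ((ContinuousLinearMap.opNorm_comp_le _ _).trans ?_)
          (norm_nonneg _) (by positivity)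
        refine mul_le_mul ((hAiH _ _).trans ?_) (hfwd _ _) (norm_nonneg _) (by positivity)
        gcongr
    _ = _ := by
        rw [Real.mul_rpow hK (by positivity), ← Real.rpow_pow_comm hlsp, mul_pow, mul_pow]
        ring

/-- Along orbits that separate at most exponentially, the cocycle is Hölder with exponentially
growing constant. -/
theorem norm_fwdCocycle_sub_le {R δ : ℝ} {x y : Xcs} (hK : 1 ≤ K) (hlam : 1 ≤ lam) (hς : 0 ≤ ς)
    (hβE : 0 ≤ βE) (hL : 0 ≤ L) (hR : 0 ≤ R) (hδ : 0 ≤ δ)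
    (hAiH : ∀ x y : Xcs,
      ‖(Ai x : Xi →L[ℝ] Xi) - (Ai y : Xi →L[ℝ] Xi)‖ ≤ L * ‖x - y‖ ^ βE)
    (hfwd : ∀ n x, ‖(fwdCocycle g Ai n x : Xi →L[ℝ] Xi)‖ ≤ K * lam ^ n)
    (hxy : ∀ n, ‖g^[n] x - g^[n] y‖ ≤ R * (1 + ς) ^ n * δ) (n : ℕ) :
    ‖(fwdCocycle g Ai n x : Xi →L[ℝ] Xi) - (fwdCocycle g Ai n y : Xi →L[ℝ] Xi)‖ ≤
      L * (R ^ βE * δ ^ βE) * (2 * (1 + ς) ^ βE * (K * lam)) ^ n := by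
  have hq : 1 ≤ (1 + ς) ^ βE := Real.one_le_rpow (by linarith) hβE
  set q := (1 + ς) ^ βE with hqdef
  set T := L * (R ^ βE * δ ^ βE) with hT
  have hT0 : 0 ≤ T := by positivity
  have hKlam : K ≤ K * lam := le_mul_of_one_le_right (by linarith) hlam
  have hlamK : lam ≤ K * lam := le_mul_of_one_le_left (by linarith) hK
  have hA : ∀ z, ‖(Ai z : Xi →L[ℝ] Xi)‖ ≤ K * lam := fun z => by
    have h := hfwd 1 z
    rw [pow_one] at h
    exact h
  induction n with
  | zero =>
    simpa [fwdCocycle] using hT0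
  | succ n ih =>
    set M := 2 * q * (K * lam) with hM
    have hsplit : (fwdCocycle g Ai (n + 1) x : Xi →L[ℝ] Xi) -
        (fwdCocycle g Ai (n + 1) y : Xi →L[ℝ] Xi) =
        ((Ai (g^[n] x) : Xi →L[ℝ] Xi) - (Ai (g^[n] y) : Xi →L[ℝ] Xi)).comp
          (fwdCocycle g Ai n x : Xi →L[ℝ] Xi) +
        (Ai (g^[n] y) : Xi →L[ℝ] Xi).comp
          ((fwdCocycle g Ai n x : Xi →L[ℝ] Xi) - (fwdCocycle g Ai n y : Xi →L[ℝ] Xi)) := by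
      ext v
      simp [fwdCocycle]
    have hdiff : ‖(Ai (g^[n] x) : Xi →L[ℝ] Xi) - (Ai (g^[n] y) : Xi →L[ℝ] Xi)‖ ≤ T * q ^ n := by
      calc _ ≤ L * (R * (1 + ς) ^ n * δ) ^ βE := (hAiH _ _).trans (by gcongr; exact hxy n)
        _ = _ := by
          rw [Real.mul_rpow (by positivity) hδ, Real.mul_rpow hR (by positivity),
            ← Real.rpow_pow_comm (by positivity), hT, hqdef]
          ring
    have hbase : q * lam ≤ M := by nlinarith
    have hstep : K * lam + K * lam ≤ M := by nlinarith
    rw [hsplit]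
    calc _ ≤ (T * q ^ n) * (K * lam ^ n) + (K * lam) * (T * M ^ n) := by
          refine (norm_add_le _ _).trans (add_le_add ?_ ?_) <;>
            refine (ContinuousLinearMap.opNorm_comp_le _ _).trans ?_
          · exact mul_le_mul hdiff (hfwd _ _) (norm_nonneg _) (by positivity)
          · exact mul_le_mul (hA _) ih (norm_nonneg _) (by positivity)
      _ = T * (K * (q * lam) ^ n + K * lam * M ^ n) := by rw [mul_pow]; ring
      _ ≤ T * (K * lam * M ^ n + K * lam * M ^ n) := by gcongr
      _ = T * ((K * lam + K * lam) * M ^ n) := by ring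
      _ ≤ T * (M * M ^ n) := by gcongr
      _ = T * M ^ (n + 1) := by ring

theorem norm_comparison_sub_le {N e : ℝ} {y x y' x' : Xcs} (n : ℕ) (hK : 0 ≤ K)
    (hfwd : ∀ x, ‖(fwdCocycle g Ai n x : Xi →L[ℝ] Xi)‖ ≤ N)
    (hbwd : ∀ x, ‖((fwdCocycle g Ai n x).symm : Xi →L[ℝ] Xi)‖ ≤ K)
    (hx : ‖(fwdCocycle g Ai n x : Xi →L[ℝ] Xi) - (fwdCocycle g Ai n x' : Xi →L[ℝ] Xi)‖ ≤ e)
    (hy : ‖(fwdCocycle g Ai n y : Xi →L[ℝ] Xi) - (fwdCocycle g Ai n y' : Xi →L[ℝ] Xi)‖ ≤ e) :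
    ‖comparison g Ai n y x - comparison g Ai n y' x'‖ ≤ K * e + K * (e * (K * N)) := by
  have he : 0 ≤ e := (norm_nonneg _).trans hx
  have hsplit : comparison g Ai n y x - comparison g Ai n y' x' =
      ((fwdCocycle g Ai n y).symm : Xi →L[ℝ] Xi).comp
        ((fwdCocycle g Ai n x : Xi →L[ℝ] Xi) - (fwdCocycle g Ai n x' : Xi →L[ℝ] Xi)) -
      ((fwdCocycle g Ai n y).symm : Xi →L[ℝ] Xi).comp
        (((fwdCocycle g Ai n y : Xi →L[ℝ] Xi) - (fwdCocycle g Ai n y' : Xi →L[ℝ] Xi)).comp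
          (((fwdCocycle g Ai n y').symm : Xi →L[ℝ] Xi).comp
            (fwdCocycle g Ai n x' : Xi →L[ℝ] Xi))) := by
    ext v
    simp [comparison]
  rw [hsplit]
  refine (norm_sub_le _ _).trans (add_le_add ?_ ?_) <;>
    refine (ContinuousLinearMap.opNorm_comp_le _ _).trans ?_
  · exact mul_le_mul (hbwd _) hx (norm_nonneg _) hK
  · refine mul_le_mul (hbwd _) ((ContinuousLinearMap.opNorm_comp_le _ _).trans ?_)
      (norm_nonneg _) hK
    refine mul_le_mul hy ((ContinuousLinearMap.opNorm_comp_le _ _).trans ?_) (norm_nonneg _) he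
    exact mul_le_mul (hbwd _) (hfwd _) (norm_nonneg _) hK

end Cocycle

/-- Existence, conjugation property, and Hölder continuity of the
transfer limit `B_i(x_cs) = lim_n 𝒜_i(0,n;x_c) 𝒜_i(n,0;x_cs)`. -/
theorem transfer_limit_exists_and_is_holder
    {Xcs Xi : Type*} [NormedAddCommGroup Xcs] [NormedSpace ℝ Xcs]
    [FiniteDimensional ℝ Xcs]
    [NormedAddCommGroup Xi] [NormedSpace ℝ Xi] [FiniteDimensional ℝ Xi]
    (πc : Xcs →L[ℝ] Xcs) (hπc : πc.comp πc = πc)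
    (g : Xcs → Xcs) (hg : ∀ x : Xcs, πc x = x → πc (g x) = g x)
    (Ut : Set Xcs)
    (K lsp ς lam βE L : ℝ)
    (hK : 1 ≤ K) (hlsp0 : 0 < lsp) (hlsp1 : lsp < 1)
    (hς : 0 < ς) (hlam : 1 < lam) (hςlam : ς < lam - 1)
    (hβE : 0 < βE) (hL : 0 ≤ L)
    -- the stable foliation of `g` is straightened on `Ũ`
    (hstraight : ∀ x ∈ Ut, ∀ k : ℕ,
      πc (g^[k] x) = g^[k] (πc x) ∧ ‖g^[k] x - g^[k] (πc x)‖ ≤ K * lsp ^ k)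
    (hLip : ∀ y ∈ Ut, ∀ y' ∈ Ut, ∀ k : ℕ,
      ‖g^[k] y - g^[k] y'‖ ≤ K * (1 + ς) ^ k * ‖y - y'‖)
    -- the `β_E`-Hölder family `A_i` and the bounds on its cocycle
    (Ai : Xcs → (Xi ≃L[ℝ] Xi))
    (hAiH : ∀ x y : Xcs,
      ‖(Ai x : Xi →L[ℝ] Xi) - (Ai y : Xi →L[ℝ] Xi)‖ ≤ L * ‖x - y‖ ^ βE)
    (hfwd : ∀ (n : ℕ) (x : Xcs),
      ‖(fwdCocycle g Ai n x : Xi →L[ℝ] Xi)‖ ≤ K * (lam + ς) ^ n)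
    (hbwd : ∀ (n : ℕ) (x : Xcs),
      ‖((fwdCocycle g Ai n x).symm : Xi →L[ℝ] Xi)‖ ≤ K * (1 / (lam - ς)) ^ n)
    -- the key convergence condition
    (hkey : (lam + ς) / (lam - ς) * lsp ^ βE < 1) :
    ∃ B : Xcs → (Xi →L[ℝ] Xi), ∃ C > (0 : ℝ), ∃ βi > (0 : ℝ),
      -- existence of the limit
      (∀ x ∈ Ut, Tendsto (fun n : ℕ =>
          (((fwdCocycle g Ai n (πc x)).symm : Xi →L[ℝ] Xi)).comp
            ((fwdCocycle g Ai n x : Xi →L[ℝ] Xi)))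
        atTop (𝓝 (B x))) ∧
      -- `B_i = id` on `Ũ ∩ X_c`
      (∀ x ∈ Ut, πc x = x → B x = ContinuousLinearMap.id ℝ Xi) ∧
      -- the conjugation identity
      (∀ x ∈ Ut, g x ∈ Ut →
        (B (g x)).comp (Ai x : Xi →L[ℝ] Xi)
          = ((Ai (πc x) : Xi →L[ℝ] Xi)).comp (B x)) ∧
      -- Hölder continuity on `Ũ`
      (∀ x ∈ Ut, ∀ y ∈ Ut, ‖B x - B y‖ ≤ C * ‖x - y‖ ^ βi) := by
  have hK0 : 0 ≤ K := by linarith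
  have hν1 : 1 ≤ lam + ς := by linarith
  have hν0 : 0 ≤ lam + ς := by linarith
  have hgap : 1 < lam - ς := by linarith
  have hμ0 : 0 < 1 / (lam - ς) := by positivity
  have hμ1 : 1 / (lam - ς) ≤ 1 := (div_le_one (by linarith)).2 hgap.le
  set μ := 1 / (lam - ς) with hμ
  set ρ := (lam + ς) * μ * lsp ^ βE with hρ
  have hρ0 : 0 < ρ := by positivity
  have hρ1 : ρ < 1 := by rwa [hρ, hμ, mul_one_div]
  set P : ℕ → Xcs → (Xi →L[ℝ] Xi) := fun n x => comparison g Ai n (πc x) x with hP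
  set B : Xcs → (Xi →L[ℝ] Xi) := fun x => limUnder atTop fun n => P n x with hB
  have hinc : ∀ x ∈ Ut, ∀ n, ‖P (n + 1) x - P n x‖ ≤ K * μ * (L * K ^ βE) * K * ρ ^ n :=
    fun x hx n => norm_comparison_succ_sub_le hK0 hμ0.le hlsp0.le hβE.le hL hAiH hfwd hbwd n
      (hstraight x hx n).2
  have : CompleteSpace Xi := FiniteDimensional.complete ℝ Xi
  have hlim : ∀ x ∈ Ut, Tendsto (fun n => P n x) atTop (𝓝 (B x)) := fun x hx =>
    (cauchySeq_of_le_geometric ρ _ hρ1 fun n => by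
      rw [dist_comm, dist_eq_norm]; exact hinc x hx n).tendsto_limUnder
  set R := K * (1 + ‖πc‖) with hR
  have hR0 : 0 ≤ R := by positivity
  set M := 2 * (1 + ς) ^ βE * (K * (lam + ς)) with hM
  have hM0 : 0 < M := by positivity
  have hhol : ∀ x ∈ Ut, ∀ y ∈ Ut, ∀ n, ‖P n x - P n y‖ ≤
      (K * L * R ^ βE * (1 + K * K)) * (M * (lam + ς)) ^ n * ‖x - y‖ ^ βE := by
    intro x hx y hy n
    have hsep : ∀ k, ‖g^[k] x - g^[k] y‖ ≤ R * (1 + ς) ^ k * ‖x - y‖ := fun k => by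
      refine (hLip x hx y hy k).trans ?_
      gcongr
      exact le_mul_of_one_le_right hK0 (by linarith [norm_nonneg πc])
    have hsepc : ∀ k, ‖g^[k] (πc x) - g^[k] (πc y)‖ ≤ R * (1 + ς) ^ k * ‖x - y‖ := fun k => by
      rw [← (hstraight x hx k).1, ← (hstraight y hy k).1, ← map_sub]
      calc _ ≤ ‖πc‖ * (K * (1 + ς) ^ k * ‖x - y‖) :=
            (πc.le_opNorm _).trans (by gcongr; exact hLip x hx y hy k)
        _ ≤ (1 + ‖πc‖) * (K * (1 + ς) ^ k * ‖x - y‖) := by gcongr; linarith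
        _ = _ := by rw [hR]; ring
    have hpow : 1 ≤ (lam + ς) ^ n := one_le_pow₀ hν1
    have hmain := norm_comparison_sub_le n hK0 (hfwd n)
      (fun z => (hbwd n z).trans (mul_le_of_le_one_right hK0 (pow_le_one₀ hμ0.le hμ1)))
      (norm_fwdCocycle_sub_le hK hν1 hς.le hβE.le hL hR0 (norm_nonneg _) hAiH hfwd hsep n)
      (norm_fwdCocycle_sub_le hK hν1 hς.le hβE.le hL hR0 (norm_nonneg _) hAiH hfwd hsepc n)
    rw [← hM] at hmain
    calc _ ≤ _ := hmain
      _ = K * L * R ^ βE * M ^ n * ‖x - y‖ ^ βE * (1 + K * K * (lam + ς) ^ n) := by ring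
      _ ≤ K * L * R ^ βE * M ^ n * ‖x - y‖ ^ βE *
          ((lam + ς) ^ n + K * K * (lam + ς) ^ n) := by gcongr
      _ = _ := by rw [mul_pow M]; ring
  obtain ⟨C, hC, γ, hγ, hBhol⟩ := exists_holder_of_tendsto_of_geometric (by positivity) hρ0 hρ1
    (by positivity) (by positivity) hβE hlim (fun x _ y _ => rfl) hinc hhol
  refine ⟨B, C, hC, γ, hγ, hlim, fun x hx hxc => ?_, fun x hx hgx => ?_, hBhol⟩
  · refine tendsto_nhds_unique (hlim x hx) (tendsto_const_nhds.congr fun n => ?_)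
    ext v
    simp [hP, comparison, hxc]
  · have hcomm : πc (g x) = g (πc x) := (hstraight x hx 1).1
    have hleft : Tendsto (fun n => (P n (g x)).comp (Ai x : Xi →L[ℝ] Xi)) atTop
        (𝓝 ((B (g x)).comp (Ai x : Xi →L[ℝ] Xi))) :=
      ((continuous_id.clm_comp continuous_const).tendsto _).comp (hlim _ hgx)
    have hright : Tendsto (fun n => (Ai (πc x) : Xi →L[ℝ] Xi).comp (P (n + 1) x)) atTop
        (𝓝 ((Ai (πc x) : Xi →L[ℝ] Xi).comp (B x))) :=
      ((continuous_const.clm_comp continuous_id).tendsto _).comp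
        ((hlim x hx).comp (tendsto_add_atTop_nat 1))
    refine tendsto_nhds_unique hleft (hright.congr fun n => ?_)
    simp only [hP, hcomm, comparison_comp]
end
end

section
/- Hölder exponent of a functional series: let (Y, ‖·‖) be a Banach space, Ω ⊆ Y a small neighborhood of the origin O, and Γ_k : Ω → Y (k ≥ 0 integers) α-Hölder maps (α ∈ (0,1]) such that ‖Γ_k(y)‖ ≤ Cτ_1^k and ‖Γ_k(y) − Γ_k(ỹ)‖ ≤ Cτ_2^k‖y − ỹ‖^α for all y, ỹ ∈ Ω, with positive constants C, τ_1, τ_2. If ρ > 0 satisfies ρτ_1 < 1, then Σ_{k=0}^∞ ρ^k‖Γ_k(y) − Γ_k(ỹ)‖ ≤ C'‖y − ỹ‖^{β̄} for all y, ỹ near O, where β̄ := α if ρτ_2 < 1; β̄ := α − ε (for an arbitrarily small given ε > 0) if ρτ_2 = 1; and β̄ := α(log τ_1 + log ρ)/(log τ_1 − log τ_2) if ρτ_2 > 1; in each case β̄ > 0. -/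
noncomputable section

open Filter Topology
open scoped Classical

theorem sum_geometric_le {r : ℝ} (hr0 : 0 ≤ r) (hr1 : r < 1) (N : ℕ) :
    ∑ k ∈ Finset.range N, r ^ k ≤ (1 - r)⁻¹ := by
  rw [← tsum_geometric_of_lt_one hr0 hr1]
  exact (summable_geometric_of_lt_one hr0 hr1).sum_le_tsum _ fun k _ => pow_nonneg hr0 k

/-- Two competing geometric bounds, one decaying and one constant in the index. -/
theorem sum_le_of_geometric_of_const {f : ℕ → ℝ} {D a t θ : ℝ} (hD : 0 ≤ D)
    (ha0 : 0 < a) (ha1 : a < 1) (ht : 0 < t) (hθ0 : 0 ≤ θ) (hθ1 : θ < 1)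
    (h₁ : ∀ k, f k ≤ D * a ^ k) (h₂ : ∀ k, f k ≤ D * t) (N : ℕ) :
    ∑ k ∈ Finset.range N, f k ≤ D * (1 - a ^ (1 - θ))⁻¹ * t ^ θ := by
  have hr0 : 0 ≤ a ^ (1 - θ) := by positivity
  have hr1 : a ^ (1 - θ) < 1 := Real.rpow_lt_one ha0.le ha1 (by linarith)
  have key : ∀ k, f k ≤ D * t ^ θ * (a ^ (1 - θ)) ^ k := by
    intro k
    have hm : f k ≤ D * min t (a ^ k) := by
      rcases min_choice t (a ^ k) with h | h <;> rw [h]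
      exacts [h₂ k, h₁ k]
    have hm0 : 0 < min t (a ^ k) := lt_min ht (by positivity)
    have hpow : (a ^ (1 - θ)) ^ k = (a ^ k) ^ (1 - θ) := by
      rw [← Real.rpow_mul_natCast ha0.le, ← Real.rpow_natCast_mul ha0.le, mul_comm]
    calc f k ≤ D * min t (a ^ k) := hm
      _ = D * (min t (a ^ k) ^ θ * min t (a ^ k) ^ (1 - θ)) := by
          rw [← Real.rpow_add hm0, add_sub_cancel, Real.rpow_one]
      _ ≤ D * (t ^ θ * (a ^ k) ^ (1 - θ)) := by
          gcongr
          · exact min_le_left _ _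
          · exact min_le_right _ _
      _ = D * t ^ θ * (a ^ (1 - θ)) ^ k := by rw [hpow, mul_assoc]
  calc ∑ k ∈ Finset.range N, f k
      ≤ ∑ k ∈ Finset.range N, D * t ^ θ * (a ^ (1 - θ)) ^ k := Finset.sum_le_sum fun k _ => key k
    _ = D * t ^ θ * ∑ k ∈ Finset.range N, (a ^ (1 - θ)) ^ k := by rw [Finset.mul_sum]
    _ ≤ D * t ^ θ * (1 - a ^ (1 - θ))⁻¹ := by
        gcongr
        exact sum_geometric_le hr0 hr1 N
    _ = D * (1 - a ^ (1 - θ))⁻¹ * t ^ θ := by ring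

/-- The index at which `a ^ n` and `b ^ n * t` balance, for `a < 1 < b` and `t ≤ 1`. -/
theorem exists_nat_pow_le_rpow {a b t : ℝ} (ha0 : 0 < a) (ha1 : a < 1) (hb : 1 < b)
    (ht0 : 0 < t) (ht1 : t ≤ 1) :
    ∃ n : ℕ, a ^ n ≤ t ^ (Real.log a / (Real.log a - Real.log b)) ∧
      b ^ n * t ≤ b * t ^ (Real.log a / (Real.log a - Real.log b)) := by
  have hla : Real.log a < 0 := Real.log_neg ha0 ha1
  have hlb : 0 < Real.log b := Real.log_pos hb
  have hlt : Real.log t ≤ 0 := Real.log_nonpos ht0.le ht1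
  have hne : Real.log a - Real.log b ≠ 0 := by linarith
  have hb0 : 0 < b := by linarith
  set s := Real.log t / (Real.log a - Real.log b) with hs
  have hs0 : 0 ≤ s := div_nonneg_of_nonpos hlt (by linarith)
  refine ⟨⌈s⌉₊, ?_, ?_⟩
  · calc a ^ ⌈s⌉₊ = a ^ (⌈s⌉₊ : ℝ) := (Real.rpow_natCast _ _).symm
      _ ≤ a ^ s := Real.rpow_le_rpow_of_exponent_ge ha0 ha1.le (Nat.le_ceil s)
      _ = t ^ (Real.log a / (Real.log a - Real.log b)) := by
          rw [Real.rpow_def_of_pos ha0, Real.rpow_def_of_pos ht0, hs]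
          congr 1
          ring
  · calc b ^ ⌈s⌉₊ * t = b ^ (⌈s⌉₊ : ℝ) * t := by rw [Real.rpow_natCast]
      _ ≤ b ^ (s + 1) * t := by
          gcongr
          · exact hb.le
          · exact (Nat.ceil_lt_add_one hs0).le
      _ = b * (b ^ s * t) := by rw [Real.rpow_add_one hb0.ne']; ring
      _ = b * t ^ (Real.log a / (Real.log a - Real.log b)) := by
          congr 1
          have hexp : Real.exp (Real.log b * s) * t = Real.exp (Real.log b * s + Real.log t) := by
            rw [Real.exp_add, Real.exp_log ht0]
          rw [Real.rpow_def_of_pos hb0, Real.rpow_def_of_pos ht0, hexp, hs]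
          congr 1
          field_simp
          ring

/-- Two competing geometric bounds, one decaying and one growing in the index. -/
theorem sum_le_of_geometric_of_geometric {f : ℕ → ℝ} {D a b t : ℝ} (hD : 0 ≤ D)
    (ha0 : 0 < a) (ha1 : a < 1) (hb : 1 < b) (ht0 : 0 < t) (ht1 : t ≤ 1)
    (hf : ∀ k, 0 ≤ f k) (h₁ : ∀ k, f k ≤ D * a ^ k) (h₂ : ∀ k, f k ≤ D * (b ^ k * t)) (N : ℕ) :
    ∑ k ∈ Finset.range N, f k ≤
      D * (b / (b - 1) + (1 - a)⁻¹) * t ^ (Real.log a / (Real.log a - Real.log b)) := by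
  obtain ⟨n, hna, hnb⟩ := exists_nat_pow_le_rpow ha0 ha1 hb ht0 ht1
  set u := t ^ (Real.log a / (Real.log a - Real.log b))
  have hb1 : 0 < b - 1 := by linarith
  have ha2 : 0 < 1 - a := by linarith
  have head : ∑ k ∈ Finset.range n, f k ≤ D * (b / (b - 1) * u) :=
    calc ∑ k ∈ Finset.range n, f k
        ≤ ∑ k ∈ Finset.range n, D * (b ^ k * t) := Finset.sum_le_sum fun k _ => h₂ k
      _ = D * ((b ^ n - 1) / (b - 1) * t) := by
          rw [← Finset.mul_sum, ← Finset.sum_mul, geom_sum_eq hb.ne']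
      _ = D * ((b ^ n * t - t) / (b - 1)) := by ring
      _ ≤ D * (b * u / (b - 1)) := by
          gcongr
          linarith
      _ = D * (b / (b - 1) * u) := by ring
  have tail : ∑ k ∈ Finset.range N, f (n + k) ≤ D * ((1 - a)⁻¹ * u) :=
    calc ∑ k ∈ Finset.range N, f (n + k)
        ≤ ∑ k ∈ Finset.range N, D * a ^ (n + k) := Finset.sum_le_sum fun k _ => h₁ _
      _ = D * ((∑ k ∈ Finset.range N, a ^ k) * a ^ n) := by
          rw [← Finset.mul_sum, Finset.sum_mul]
          congr 1
          exact Finset.sum_congr rfl fun k _ => by ring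
      _ ≤ D * ((1 - a)⁻¹ * u) := by
          gcongr
          exact sum_geometric_le ha0.le ha1 N
  calc ∑ k ∈ Finset.range N, f k
      ≤ ∑ k ∈ Finset.range (n + N), f k :=
        Finset.sum_le_sum_of_subset_of_nonneg
          (Finset.range_subset_range.2 (Nat.le_add_left N n)) fun k _ _ => hf k
    _ = ∑ k ∈ Finset.range n, f k + ∑ k ∈ Finset.range N, f (n + k) :=
        Finset.sum_range_add _ _ _
    _ ≤ D * (b / (b - 1) * u) + D * ((1 - a)⁻¹ * u) := add_le_add head tail
    _ = D * (b / (b - 1) + (1 - a)⁻¹) * u := by ring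

/-- Hölder exponent of a functional series (Zhang–Zhang–Jarczyk):
if `‖Γ_k(y)‖ ≤ C τ₁^k` and `Γ_k` is `α`-Hölder with constant `C τ₂^k`, and `ρ τ₁ < 1`,
then `Σ ρ^k ‖Γ_k(y) − Γ_k(ỹ)‖ ≤ C' ‖y − ỹ‖^β̄` near the origin, where `β̄` is `α`,
`α − ε`, or `α (log τ₁ + log ρ)/(log τ₁ − log τ₂)` according as `ρ τ₂` is `< 1`,
`= 1`, or `> 1`; in each case `β̄ > 0`. -/
theorem holder_exponent_of_series
    {Y : Type*} [NormedAddCommGroup Y] [NormedSpace ℝ Y]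
    (Ω : Set Y) (hΩ : Ω ∈ 𝓝 (0 : Y))
    (Γ : ℕ → Y → Y) (α C τ₁ τ₂ ρ ε : ℝ)
    (hα0 : 0 < α) (hα1 : α ≤ 1) (hC : 0 < C)
    (hτ₁ : 0 < τ₁) (hτ₂ : 0 < τ₂)
    (hε0 : 0 < ε) (hεα : ε < α)
    (hbd : ∀ k : ℕ, ∀ y ∈ Ω, ‖Γ k y‖ ≤ C * τ₁ ^ k)
    (hH : ∀ k : ℕ, ∀ y ∈ Ω, ∀ y' ∈ Ω, ‖Γ k y - Γ k y'‖ ≤ C * τ₂ ^ k * ‖y - y'‖ ^ α)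
    (hρ : 0 < ρ) (hρτ₁ : ρ * τ₁ < 1) :
    -- with `β̄` defined by the indicated case distinction:
    (if ρ * τ₂ < 1 then α
     else if ρ * τ₂ = 1 then α - ε
     else α * (Real.log τ₁ + Real.log ρ) / (Real.log τ₁ - Real.log τ₂)) > 0 ∧
    ∃ C' > (0 : ℝ), ∃ V ∈ 𝓝 (0 : Y), V ⊆ Ω ∧
      ∀ y ∈ V, ∀ y' ∈ V, ∀ N : ℕ,
        ∑ k ∈ Finset.range N, ρ ^ k * ‖Γ k y - Γ k y'‖
          ≤ C' * ‖y - y'‖ ^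
            (if ρ * τ₂ < 1 then α
             else if ρ * τ₂ = 1 then α - ε
             else α * (Real.log τ₁ + Real.log ρ) / (Real.log τ₁ - Real.log τ₂)) := by
  have ha0 : 0 < ρ * τ₁ := by positivity
  have hb0 : 0 < ρ * τ₂ := by positivity
  have hloga : Real.log (ρ * τ₁) = Real.log τ₁ + Real.log ρ := by
    rw [Real.log_mul hρ.ne' hτ₁.ne', add_comm]
  have hlogb : Real.log (ρ * τ₂) = Real.log τ₂ + Real.log ρ := by
    rw [Real.log_mul hρ.ne' hτ₂.ne', add_comm]
  have hla : Real.log (ρ * τ₁) < 0 := Real.log_neg ha0 hρτ₁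
  have hβ : α * (Real.log τ₁ + Real.log ρ) / (Real.log τ₁ - Real.log τ₂) =
      α * (Real.log (ρ * τ₁) / (Real.log (ρ * τ₁) - Real.log (ρ * τ₂))) := by
    rw [hloga, hlogb, add_sub_add_right_eq_sub, mul_div_assoc]
  have pos : (if ρ * τ₂ < 1 then α
      else if ρ * τ₂ = 1 then α - ε
      else α * (Real.log τ₁ + Real.log ρ) / (Real.log τ₁ - Real.log τ₂)) > 0 := by
    split_ifs with h1 h2
    · exact hα0
    · linarith
    · have hlb : 0 < Real.log (ρ * τ₂) :=
        Real.log_pos (lt_of_le_of_ne (not_lt.1 h1) (Ne.symm h2))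
      rw [hβ]
      exact mul_pos hα0 (div_pos_of_neg_of_neg hla (by linarith))
  refine ⟨pos, ?_⟩
  suffices H : ∃ C' > (0 : ℝ), ∀ y ∈ Ω, ∀ y' ∈ Ω, 0 < ‖y - y'‖ → ‖y - y'‖ ≤ 1 → ∀ N : ℕ,
      ∑ k ∈ Finset.range N, ρ ^ k * ‖Γ k y - Γ k y'‖
        ≤ C' * ‖y - y'‖ ^
          (if ρ * τ₂ < 1 then α
           else if ρ * τ₂ = 1 then α - ε
           else α * (Real.log τ₁ + Real.log ρ) / (Real.log τ₁ - Real.log τ₂)) by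
    obtain ⟨C', hC', H⟩ := H
    refine ⟨C', hC', Ω ∩ Metric.ball 0 (1 / 2),
      inter_mem hΩ (Metric.ball_mem_nhds _ (by norm_num)), Set.inter_subset_left, ?_⟩
    rintro y ⟨hy, hyb⟩ y' ⟨hy', hyb'⟩ N
    rcases eq_or_ne y y' with rfl | hne
    · simp [Real.zero_rpow pos.ne']
    · refine H y hy y' hy' (norm_pos_iff.2 (sub_ne_zero.2 hne)) ?_ N
      rw [mem_ball_zero_iff] at hyb hyb'
      linarith [norm_sub_le y y']
  have decay : ∀ y ∈ Ω, ∀ y' ∈ Ω, ∀ k,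
      ρ ^ k * ‖Γ k y - Γ k y'‖ ≤ 2 * C * (ρ * τ₁) ^ k := by
    intro y hy y' hy' k
    calc ρ ^ k * ‖Γ k y - Γ k y'‖ ≤ ρ ^ k * (C * τ₁ ^ k + C * τ₁ ^ k) := by
          gcongr
          exact (norm_sub_le _ _).trans (add_le_add (hbd k y hy) (hbd k y' hy'))
      _ = 2 * C * (ρ * τ₁) ^ k := by rw [mul_pow]; ring
  have holder : ∀ y ∈ Ω, ∀ y' ∈ Ω, ∀ k,
      ρ ^ k * ‖Γ k y - Γ k y'‖ ≤ 2 * C * ((ρ * τ₂) ^ k * ‖y - y'‖ ^ α) := by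
    intro y hy y' hy' k
    calc ρ ^ k * ‖Γ k y - Γ k y'‖ ≤ ρ ^ k * (C * τ₂ ^ k * ‖y - y'‖ ^ α) := by
          gcongr
          exact hH k y hy y' hy'
      _ = 1 * C * ((ρ * τ₂) ^ k * ‖y - y'‖ ^ α) := by rw [mul_pow]; ring
      _ ≤ 2 * C * ((ρ * τ₂) ^ k * ‖y - y'‖ ^ α) := by
          gcongr
          norm_num
  split_ifs with h1 h2
  · have h1' : 0 < 1 - ρ * τ₂ := by linarith
    refine ⟨2 * C * (1 - ρ * τ₂)⁻¹, by positivity, fun y hy y' hy' _ _ N => ?_⟩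
    calc ∑ k ∈ Finset.range N, ρ ^ k * ‖Γ k y - Γ k y'‖
        ≤ ∑ k ∈ Finset.range N, 2 * C * ((ρ * τ₂) ^ k * ‖y - y'‖ ^ α) :=
          Finset.sum_le_sum fun k _ => holder y hy y' hy' k
      _ = 2 * C * (∑ k ∈ Finset.range N, (ρ * τ₂) ^ k) * ‖y - y'‖ ^ α := by
          rw [← Finset.mul_sum, ← Finset.sum_mul, ← mul_assoc]
      _ ≤ 2 * C * (1 - ρ * τ₂)⁻¹ * ‖y - y'‖ ^ α := by
          gcongr
          exact sum_geometric_le hb0.le h1 N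
  · have hθ0 : 0 ≤ (α - ε) / α := div_nonneg (by linarith) hα0.le
    have hθ1 : (α - ε) / α < 1 := (div_lt_one hα0).2 (by linarith)
    have hr : 0 < 1 - (ρ * τ₁) ^ (1 - (α - ε) / α) :=
      sub_pos.2 (Real.rpow_lt_one ha0.le hρτ₁ (by linarith))
    refine ⟨2 * C * (1 - (ρ * τ₁) ^ (1 - (α - ε) / α))⁻¹, by positivity,
      fun y hy y' hy' hd _ N => ?_⟩
    have h := sum_le_of_geometric_of_const (t := ‖y - y'‖ ^ α) (by positivity : 0 ≤ 2 * C)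
      ha0 hρτ₁ (by positivity) hθ0 hθ1 (decay y hy y' hy')
      (fun k => by simpa [h2] using holder y hy y' hy' k) N
    rwa [← Real.rpow_mul hd.le, mul_div_cancel₀ _ hα0.ne'] at h
  · have hb : 1 < ρ * τ₂ := lt_of_le_of_ne (not_lt.1 h1) (Ne.symm h2)
    have hb1 : 0 < ρ * τ₂ - 1 := by linarith
    have ha1 : 0 < 1 - ρ * τ₁ := by linarith
    refine ⟨2 * C * (ρ * τ₂ / (ρ * τ₂ - 1) + (1 - ρ * τ₁)⁻¹), by positivity,
      fun y hy y' hy' hd hd1 N => ?_⟩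
    have h := sum_le_of_geometric_of_geometric (t := ‖y - y'‖ ^ α) (by positivity : 0 ≤ 2 * C)
      ha0 hρτ₁ hb (by positivity) (Real.rpow_le_one hd.le hd1 hα0.le)
      (fun k => by positivity) (decay y hy y' hy') (holder y hy y' hy') N
    rwa [← Real.rpow_mul hd.le, ← hβ] at h
end
end
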